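/- Step (iii): Let the indices run over {0,1,…,n} and let L^{αβ}_A be first-order functions, symmetric in α,β, satisfying (int1) and (int2). Let V^0 be a first-order function such that ∂^0_A V^0 = (1/2) L^{00}_A for all A and (∂^i_A ∂^j_B + ∂^j_A ∂^i_B) V^0 = T^{ij}_{AB} for all latin indices i,j ∈ {1,…,n} and all A,B, where T^{ij}_{AB} = ∂^i_B L^{0j}_A + ∂^j_B L^{0i}_A − ∂^0_A L^{ij}_B. Then the functions G^i_A = L^{0i}_A − ∂^i_A V^0 satisfy ∂^0_B G^i_A = ∂^0_A G^i_B for all i, A, B. -/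

import Mathlib

/-!
Step (iii): given `V⁰` with `∂⁰_A V⁰ = (1/2) L^{00}_A` and
`(∂ⁱ_A ∂ʲ_B + ∂ʲ_A ∂ⁱ_B) V⁰ = T^{ij}_{AB}`, the functions
`Gⁱ_A = L^{0i}_A − ∂ⁱ_A V⁰` satisfy `∂⁰_B Gⁱ_A = ∂⁰_A Gⁱ_B`.
-/

/-- The first-order jet-type space with `n+1` base indices:
`J = ℝ^{n+1} × ℝ^N × ℝ^{N×(n+1)}`. -/
abbrev J (n N : ℕ) : Type :=
  (Fin (n+1) → ℝ) × (Fin N → ℝ) × (Fin N → Fin (n+1) → ℝ)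

/-- `∂ᵅ_A f`: the partial derivative with respect to the variable `ψᴬ_α`. -/
noncomputable def pd {n N : ℕ} (A : Fin N) (α : Fin (n+1)) (f : J n N → ℝ) :
    J n N → ℝ :=
  fun p => fderiv ℝ f p (0, 0, Pi.single A (Pi.single α (1 : ℝ)))

/-- `T^{ij}_{AB} = ∂ⁱ_B L^{0j}_A + ∂ʲ_B L^{0i}_A − ∂⁰_A L^{ij}_B`
(latin indices `i, j` are the indices `1,…,n`, realized via `Fin.succ`). -/
noncomputable def Tc {n N : ℕ}
    (L : Fin (n+1) → Fin (n+1) → Fin N → J n N → ℝ)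
    (i j : Fin n) (A B : Fin N) : J n N → ℝ :=
  fun p => pd B i.succ (L 0 j.succ A) p + pd B j.succ (L 0 i.succ A) p
    - pd A 0 (L i.succ j.succ B) p

/-- `Gⁱ_A = L^{0i}_A − ∂ⁱ_A V⁰`. -/
noncomputable def Gc {n N : ℕ}
    (L : Fin (n+1) → Fin (n+1) → Fin N → J n N → ℝ) (V0 : J n N → ℝ)
    (i : Fin n) (A : Fin N) : J n N → ℝ :=
  fun p => L 0 i.succ A p - pd A i.succ V0 p

/-- Partial derivatives of a `C²` function on `J` are differentiable. -/
theorem differentiable_pd {n N : ℕ} {f : J n N → ℝ} (hf : ContDiff ℝ 2 f)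
    (A : Fin N) (α : Fin (n+1)) : Differentiable ℝ (pd A α f) :=
  ((hf.fderiv_right (m := 1) (by norm_num)).differentiable one_ne_zero).clm_apply
    (differentiable_const _)

/-- The partial derivatives `∂ᵅ_A` and `∂ᵝ_B` commute on `C²` functions. -/
theorem pd_comm {n N : ℕ} {f : J n N → ℝ} (hf : ContDiff ℝ 2 f)
    (A B : Fin N) (α β : Fin (n+1)) (p : J n N) :
    pd A α (pd B β f) p = pd B β (pd A α f) p := by
  have hd : DifferentiableAt ℝ (fderiv ℝ f) p :=
    (hf.fderiv_right (m := 1) (by norm_num)).differentiable one_ne_zero p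
  have hsymm : IsSymmSndFDerivAt ℝ f p :=
    hf.contDiffAt.isSymmSndFDerivAt (by simp)
  have key (v w : J n N) :
      fderiv ℝ (fun q => fderiv ℝ f q v) p w = fderiv ℝ (fderiv ℝ f) p w v := by
    rw [fderiv_clm_apply hd (differentiableAt_const v)]
    simp
  exact (key _ _).trans ((hsymm.eq _ _).trans (key _ _).symm)

theorem pd_sub {n N : ℕ} {f g : J n N → ℝ} (hf : Differentiable ℝ f)
    (hg : Differentiable ℝ g) (A : Fin N) (α : Fin (n+1)) (p : J n N) :
    pd A α (fun q => f q - g q) p = pd A α f p - pd A α g p := by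
  simp only [pd, fderiv_fun_sub (hf p) (hg p), sub_apply]

theorem pd_const_mul {n N : ℕ} {f : J n N → ℝ} (hf : Differentiable ℝ f) (c : ℝ)
    (A : Fin N) (α : Fin (n+1)) (p : J n N) :
    pd A α (fun q => c * f q) p = c * pd A α f p := by
  simp [pd, fderiv_const_mul (hf p)]

theorem step_iii (n N : ℕ) (hn : 0 < n) (hN : 0 < N)
    (L : Fin (n+1) → Fin (n+1) → Fin N → J n N → ℝ)
    (hLsmooth : ∀ α β A, ContDiff ℝ (⊤ : ℕ∞) (L α β A))
    (hLsym : ∀ α β A, L α β A = L β α A)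
    (hint1 : ∀ (μ ν ρ : Fin (n+1)) (A B : Fin N) (p : J n N),
      pd B ρ (L μ ν A) p + pd B μ (L ρ ν A) p + pd B ν (L μ ρ A) p =
      pd A ρ (L μ ν B) p + pd A μ (L ρ ν B) p + pd A ν (L μ ρ B) p)
    (hint2 : ∀ (μ ν ρ σ : Fin (n+1)) (A B C : Fin N) (p : J n N),
      pd B μ (fun q => pd C ρ (L σ ν A) q + pd C σ (L ρ ν A) q) p
      + pd B ν (fun q => pd C ρ (L σ μ A) q + pd C σ (L ρ μ A) q) p
      - (pd A μ (pd B ν (L σ ρ C)) p + pd A ν (pd B μ (L σ ρ C)) p)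
      - (pd A ρ (pd C σ (L μ ν B)) p + pd A σ (pd C ρ (L μ ν B)) p) = 0)
    (V0 : J n N → ℝ) (hV0smooth : ContDiff ℝ (⊤ : ℕ∞) V0)
    (hV01 : ∀ (A : Fin N) (p : J n N), pd A 0 V0 p = (1/2) * L 0 0 A p)
    (hV02 : ∀ (i j : Fin n) (A B : Fin N) (p : J n N),
      pd A i.succ (pd B j.succ V0) p + pd A j.succ (pd B i.succ V0) p =
      Tc L i j A B p) :
    ∀ (i : Fin n) (A B : Fin N) (p : J n N),
      pd B 0 (Gc L V0 i A) p = pd A 0 (Gc L V0 i B) p := by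
  have hV : ContDiff ℝ 2 V0 := hV0smooth.of_le (WithTop.coe_le_coe.mpr le_top)
  have hL (α β A) : Differentiable ℝ (L α β A) := (hLsmooth α β A).differentiable (by simp)
  have pd_G (i : Fin n) (A B : Fin N) (p : J n N) :
      pd B 0 (Gc L V0 i A) p =
        pd B 0 (L 0 i.succ A) p - (1/2) * pd A i.succ (L 0 0 B) p := by
    unfold Gc
    rw [pd_sub (hL _ _ _) (differentiable_pd hV _ _), pd_comm hV, funext (hV01 B),
      pd_const_mul (hL _ _ _)]
  intro i A B p
  have h := hint1 0 0 i.succ A B p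
  simp only [hLsym i.succ 0] at h
  rw [pd_G, pd_G]
  linarith
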